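/- arXiv:0902.0244 — 5 statements merged into one kernel-verified Lean document; each statement's English description precedes it below -/
import Mathlib

section
/- Let S = (s_IJ) ∈ M₂(k) be a matrix with det S = 1 all of whose entries satisfy s_IJ^{p²} = s_IJ (i.e. S ∈ SL₂(𝔽_{p²})). Then there exists a W-linear endomorphism φ of N, with matrix A = (a_{ij}), such that (a) φ∘F = F∘φ, (b) Aᵗ J' A = J', and (c) ρ(a₁₁) = s₁₁, ρ(a₁₃) = s₁₂, ρ(a₃₁) = s₂₁, ρ(a₃₃) = s₂₂. In other words, the reduction map π from the quaternion-hermitian unitary group {φ ∈ End_W(N) : φ∘F = F∘φ and φ preserves ⟨ , ⟩}, given by the induced action on N/V(N), is surjective onto SL₂(𝔽_{p²}). -/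
/-!
Common setup: `p` a prime, `k` an algebraically closed field of characteristic `p`,
`W = W(k)` the ring of `p`-typical Witt vectors, `σ` the Witt vector Frobenius,
`ρ : W → k` reduction (0-th coefficient), `N = W⁴` with the semilinear maps `F`, `V`,
the Gram matrix `J'` of the alternating form, the Dieudonné submodules `M_b`, and the
coordinate map `q` for `N/V(N)`.
-/

noncomputable section

open WittVector Matrix

variable (p : ℕ) [Fact p.Prime] (k : Type) [Field k] [IsAlgClosed k] [CharP k p]

/-- The reduction map `ρ : W(k) → k` sending a Witt vector to its 0-th coefficient. -/
def redW : WittVector p k →+* k where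
  toFun x := x.coeff 0
  map_one' := WittVector.one_coeff_zero p k
  map_mul' := WittVector.mul_coeff_zero
  map_zero' := WittVector.zero_coeff p k 0
  map_add' := WittVector.add_coeff_zero

/-- The Witt vector Frobenius `σ`, a ring automorphism of `W(k)` since `k` is perfect. -/
def sigmaW : WittVector p k ≃+* WittVector p k := WittVector.frobeniusEquiv p k

/-- The standard basis vectors `e₁, e₂, e₃, e₄` of `N = W⁴` (0-indexed). -/
def eW (i : Fin 4) : Fin 4 → WittVector p k := Pi.single i 1

/-- The `σ`-semilinear map `F : N → N` with `F e₁ = e₂`, `F e₂ = -p e₁`,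
`F e₃ = e₄`, `F e₄ = -p e₃`. -/
def Fmap : (Fin 4 → WittVector p k) → (Fin 4 → WittVector p k) := fun x =>
  ![-(p : WittVector p k) * sigmaW p k (x 1), sigmaW p k (x 0),
    -(p : WittVector p k) * sigmaW p k (x 3), sigmaW p k (x 2)]

/-- The `σ⁻¹`-semilinear map `V : N → N` with `V e₁ = -e₂`, `V e₂ = p e₁`,
`V e₃ = -e₄`, `V e₄ = p e₃`. -/
def Vmap : (Fin 4 → WittVector p k) → (Fin 4 → WittVector p k) := fun x =>
  ![(p : WittVector p k) * (sigmaW p k).symm (x 1), -(sigmaW p k).symm (x 0),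
    (p : WittVector p k) * (sigmaW p k).symm (x 3), -(sigmaW p k).symm (x 2)]

/-- The Gram matrix `J'` of the alternating form `⟨ , ⟩` on `N` with
`⟨e₁,e₃⟩ = 1 = -⟨e₃,e₁⟩`, `⟨e₂,e₄⟩ = p = -⟨e₄,e₂⟩`. -/
def Jmat : Matrix (Fin 4) (Fin 4) (WittVector p k) :=
  !![0, 0, 1, 0;
     0, 0, 0, (p : WittVector p k);
     -1, 0, 0, 0;
     0, -(p : WittVector p k), 0, 0]

/-- The `W`-linear endomorphism of `N` with matrix `A` commutes with `F`. -/
def CommF (A : Matrix (Fin 4) (Fin 4) (WittVector p k)) : Prop :=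
  ∀ x, A.mulVec (Fmap p k x) = Fmap p k (A.mulVec x)

/-- The `W`-submodule `M_b` of `N` spanned by `p e₁, p e₃, e₂, e₄` and `e₁ + b̃ e₃`,
where `b̃` is the Teichmüller lift of `b` (a lift of `b` under `ρ`). -/
def Mmod (b : k) : Submodule (WittVector p k) (Fin 4 → WittVector p k) :=
  Submodule.span (WittVector p k)
    {(p : WittVector p k) • eW p k 0, (p : WittVector p k) • eW p k 2, eW p k 1, eW p k 3,
     eW p k 0 + WittVector.teichmuller p b • eW p k 2}

/-- Coordinates of the class of `x ∈ N` in `N/V(N) ≃ k²` with respect to the basis given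
by the classes of `e₁` and `e₃`. -/
def qmap : (Fin 4 → WittVector p k) → (Fin 2 → k) := fun x => ![redW p k (x 0), redW p k (x 2)]

theorem sigmaW_teichmuller (x : k) :
    sigmaW p k (teichmuller p x) = teichmuller p (x ^ p) := by
  change frobenius (teichmuller p x) = _
  rw [frobenius_eq_map_frobenius, map_teichmuller, frobenius_def]

/-- Every element of `SL₂(𝔽_{p²})` lifts to `SL₂` of the fixed ring of `σ²` in `W(k)`. -/
theorem exists_sigmaW_sq_fixed_lift
    (S : Matrix (Fin 2) (Fin 2) k) (hdet : S.det = 1) (hS : ∀ i j, S i j ^ p ^ 2 = S i j) :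
    ∃ M : Matrix (Fin 2) (Fin 2) (WittVector p k), M.det = 1 ∧
      (∀ i j, sigmaW p k (sigmaW p k (M i j)) = M i j) ∧ ∀ i j, redW p k (M i j) = S i j := by
  have hfix (i j) : sigmaW p k (sigmaW p k (teichmuller p (S i j))) = teichmuller p (S i j) := by
    rw [sigmaW_teichmuller, sigmaW_teichmuller, ← pow_mul, ← pow_two, hS]
  have hred (x : k) : redW p k (teichmuller p x) = x := teichmuller_coeff_zero p x
  set T : Matrix (Fin 2) (Fin 2) (WittVector p k) := S.map (teichmuller p)
  have hTfix (i j) : sigmaW p k (sigmaW p k (T i j)) = T i j := hfix i j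
  have hTred (i j) : redW p k (T i j) = S i j := hred _
  have hδred : redW p k T.det = 1 := by
    rw [← hdet, det_fin_two, det_fin_two]
    simp only [map_sub, map_mul, hTred]
  have hδfix : sigmaW p k (sigmaW p k T.det) = T.det := by
    rw [det_fin_two]
    simp only [map_sub, map_mul, hTfix]
  have hδ : IsUnit T.det := isUnit_of_coeff_zero_ne_zero _ (by
    change redW p k T.det ≠ 0
    simp [hδred])
  obtain ⟨u, hu⟩ := hδ.exists_right_inv
  have hufix : sigmaW p k (sigmaW p k u) = u := by
    apply hδ.mul_left_cancel
    conv_lhs => rw [← hδfix, ← map_mul, ← map_mul, hu, map_one, map_one]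
    exact hu.symm
  have hured : redW p k u = 1 := by
    simpa [hδred] using congrArg (redW p k) hu
  refine ⟨!![T 0 0 * u, T 0 1; T 1 0 * u, T 1 1], ?_, ?_, ?_⟩
  · rw [det_fin_two] at hu
    rw [det_fin_two_of]
    linear_combination hu
  · intro i j
    fin_cases i <;> fin_cases j <;> simp [hTfix, hufix]
  · intro i j
    fin_cases i <;> fin_cases j <;> simp [hTred, hured]

/-- the reduction map `π` from the group
`{φ ∈ End_W(N) : φ∘F = F∘φ, φ preserves ⟨ , ⟩}` to `SL₂(𝔽_{p²})` is surjective. -/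
theorem surjectivity_onto_SL2
    (S : Matrix (Fin 2) (Fin 2) k) (hdet : S.det = 1)
    (hS : ∀ i j, S i j ^ p ^ 2 = S i j) :
    ∃ A : Matrix (Fin 4) (Fin 4) (WittVector p k),
      CommF p k A ∧
      Aᵀ * Jmat p k * A = Jmat p k ∧
      redW p k (A 0 0) = S 0 0 ∧ redW p k (A 0 2) = S 0 1 ∧
      redW p k (A 2 0) = S 1 0 ∧ redW p k (A 2 2) = S 1 1 := by
  obtain ⟨M, hM, hfix, hred⟩ := exists_sigmaW_sq_fixed_lift p k S hdet hS
  have hσM := congrArg (sigmaW p k) hM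
  rw [det_fin_two] at hM hσM
  simp only [map_sub, map_mul, map_one] at hσM
  refine ⟨!![M 0 0, 0, M 0 1, 0;
             0, sigmaW p k (M 0 0), 0, sigmaW p k (M 0 1);
             M 1 0, 0, M 1 1, 0;
             0, sigmaW p k (M 1 0), 0, sigmaW p k (M 1 1)],
    ?_, ?_, hred 0 0, hred 0 1, hred 1 0, hred 1 1⟩
  · intro x
    ext1 i
    fin_cases i <;>
      simp [Fmap, mulVec, dotProduct, Fin.sum_univ_four, hfix] <;> ring
  · ext1 i j
    fin_cases i <;> fin_cases j <;>
      simp [Jmat, mul_apply, Fin.sum_univ_four] <;>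
      first
        | ring1
        | linear_combination hM
        | linear_combination -hM
        | linear_combination (p : WittVector p k) * hσM
        | linear_combination -(p : WittVector p k) * hσM

end
end

section
/- Let φ be a W-linear endomorphism of N with matrix A = (a_{ij}) such that φ∘F = F∘φ and Aᵗ J' A = J'. Then the 2×2 matrix S = ((ρ(a₁₁), ρ(a₁₃)), (ρ(a₃₁), ρ(a₃₃))) of the induced k-linear map on N/V(N) (with respect to the basis given by the classes of e₁ and e₃) has determinant 1, and every entry x of S satisfies x^{p²} = x; that is, S ∈ SL₂(𝔽_{p²}). -/
/-!
Common setup: `p` a prime, `k` an algebraically closed field of characteristic `p`,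
`W = W(k)` the ring of `p`-typical Witt vectors, `σ` the Witt vector Frobenius,
`ρ : W → k` reduction (0-th coefficient), `N = W⁴` with the semilinear maps `F`, `V`,
the Gram matrix `J'` of the alternating form, the Dieudonné submodules `M_b`, and the
coordinate map `q` for `N/V(N)`.
-/

noncomputable section

open WittVector Matrix

variable (p : ℕ) [Fact p.Prime] (k : Type) [Field k] [IsAlgClosed k] [CharP k p]

theorem redW_sigmaW (x : WittVector p k) : redW p k (sigmaW p k x) = redW p k x ^ p :=
  WittVector.coeff_frobenius_charP p x 0

theorem Fmap_eW_zero : Fmap p k (eW p k 0) = eW p k 1 := by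
  funext i; fin_cases i <;> simp [Fmap, eW]

theorem Fmap_eW_one : Fmap p k (eW p k 1) = -(p : WittVector p k) • eW p k 0 := by
  funext i; fin_cases i <;> simp [Fmap, eW]

theorem Fmap_eW_two : Fmap p k (eW p k 2) = eW p k 3 := by
  funext i; fin_cases i <;> simp [Fmap, eW]

theorem Fmap_eW_three : Fmap p k (eW p k 3) = -(p : WittVector p k) • eW p k 2 := by
  funext i; fin_cases i <;> simp [Fmap, eW]

variable {p k}

/-- If `A` commutes with `F` and `F e_i = e_j`, then `F` sends the `i`-th column of `A` to its
`j`-th one. -/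
theorem CommF.col_eq {A : Matrix (Fin 4) (Fin 4) (WittVector p k)} (hF : CommF p k A)
    {i j : Fin 4} (hij : Fmap p k (eW p k i) = eW p k j) :
    A.col j = Fmap p k (A.col i) := by
  have h := hF (eW p k i)
  rw [hij] at h
  simpa only [eW, Matrix.mulVec_single_one] using h

/-- If `F e_j = -p e_i`, then `F` sends the `j`-th column of `A` to `-p` times its `i`-th one. -/
theorem CommF.neg_p_smul_col_eq {A : Matrix (Fin 4) (Fin 4) (WittVector p k)} (hF : CommF p k A)
    {i j : Fin 4} (hij : Fmap p k (eW p k j) = -(p : WittVector p k) • eW p k i) :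
    -(p : WittVector p k) • A.col i = Fmap p k (A.col j) := by
  have h := hF (eW p k j)
  rw [hij, Matrix.mulVec_smul] at h
  simpa only [eW, Matrix.mulVec_single_one] using h

/-- The entries of `A` in the rows of `e₁` and `e₃` and a column `i` with `F² e_i = -p e_i` have
reductions in `𝔽_{p²}`. -/
theorem CommF.redW_pow_eq {A : Matrix (Fin 4) (Fin 4) (WittVector p k)} (hF : CommF p k A)
    {i j : Fin 4} (hij : Fmap p k (eW p k i) = eW p k j)
    (hji : Fmap p k (eW p k j) = -(p : WittVector p k) • eW p k i) :
    redW p k (A 0 i) ^ p ^ 2 = redW p k (A 0 i) ∧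
      redW p k (A 2 i) ^ p ^ 2 = redW p k (A 2 i) := by
  have h := hF.col_eq hij
  have h' := hF.neg_p_smul_col_eq hji
  have hp : -(p : WittVector p k) ≠ 0 := neg_ne_zero.mpr (WittVector.p_nonzero p k)
  have h1 : A 1 j = sigmaW p k (A 0 i) := congrFun h 1
  have h3 : A 3 j = sigmaW p k (A 2 i) := congrFun h 3
  have h0 : A 0 i = sigmaW p k (A 1 j) := mul_left_cancel₀ hp (congrFun h' 0)
  have h2 : A 2 i = sigmaW p k (A 3 j) := mul_left_cancel₀ hp (congrFun h' 2)
  rw [h1] at h0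
  rw [h3] at h2
  constructor
  · conv_rhs => rw [h0, redW_sigmaW, redW_sigmaW, ← pow_mul, ← sq]
  · conv_rhs => rw [h2, redW_sigmaW, redW_sigmaW, ← pow_mul, ← sq]

variable (p k)

/-- if `φ` commutes with `F` and preserves the form, then the induced matrix
on `N/V(N)` lies in `SL₂(𝔽_{p²})`. -/
theorem reduction_mem_SL2
    (A : Matrix (Fin 4) (Fin 4) (WittVector p k))
    (hF : CommF p k A) (hJ : Aᵀ * Jmat p k * A = Jmat p k) :
    (!![redW p k (A 0 0), redW p k (A 0 2);
        redW p k (A 2 0), redW p k (A 2 2)]).det = 1 ∧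
    ∀ i j, (!![redW p k (A 0 0), redW p k (A 0 2);
               redW p k (A 2 0), redW p k (A 2 2)]) i j ^ p ^ 2 =
           (!![redW p k (A 0 0), redW p k (A 0 2);
               redW p k (A 2 0), redW p k (A 2 2)]) i j := by
  have h₁ := hF.redW_pow_eq (Fmap_eW_zero p k) (Fmap_eW_one p k)
  have h₃ := hF.redW_pow_eq (Fmap_eW_two p k) (Fmap_eW_three p k)
  constructor
  · have h := congrArg (redW p k) (congrFun (congrFun hJ 0) 2)
    simp [Matrix.mul_apply, Fin.sum_univ_four, Jmat, CharP.cast_eq_zero] at h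
    rw [Matrix.det_fin_two_of]
    linear_combination h
  · intro i j
    fin_cases i <;> fin_cases j
    exacts [h₁.1, h₃.1, h₁.2, h₃.2]

end
end

section
/- A W-linear endomorphism φ of N with matrix A = (a_{ij}) commutes with F (φ∘F = F∘φ) if and only if for all I, J ∈ {1,2} one has a_{2I−1,2J−1} = σ(a_{2I,2J}), a_{2I−1,2J} = −p·σ(a_{2I,2J−1}), σ²(a_{2I,2J}) = a_{2I,2J}, and σ²(a_{2I,2J−1}) = a_{2I,2J−1}. (That is, A decomposes into 2×2 blocks of the form ((a, −p·σ(c)), (c, σ(a))) with a, c fixed by σ², which realizes the ring of F-commuting W-linear endomorphisms of N as M₂(O_D), where O_D = W(𝔽_{p²})[Π] with Π² = −p and Πa = σ(a)Π.) -/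
/-!
Common setup: `p` a prime, `k` an algebraically closed field of characteristic `p`,
`W = W(k)` the ring of `p`-typical Witt vectors, `σ` the Witt vector Frobenius,
`ρ : W → k` reduction (0-th coefficient), `N = W⁴` with the semilinear maps `F`, `V`,
the Gram matrix `J'` of the alternating form, the Dieudonné submodules `M_b`, and the
coordinate map `q` for `N/V(N)`.
-/

noncomputable section

open WittVector Matrix

variable (p : ℕ) [Fact p.Prime] (k : Type) [Field k] [IsAlgClosed k] [CharP k p]

/-- `φ` commutes with `F` iff its matrix decomposes into 2×2 blocks of the
form `((a, -p·σ(c)), (c, σ(a)))` with `a, c` fixed by `σ²` (so that the `F`-commuting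
endomorphism ring of `N` is `M₂(O_D)`). Indices here are 0-based: the 1-indexed entry
`a_{2I-1,2J-1}` is `A ⟨2i,_⟩ ⟨2j,_⟩` for `i = I-1`, `j = J-1`. -/
theorem commF_iff_block_form
    (A : Matrix (Fin 4) (Fin 4) (WittVector p k)) :
    CommF p k A ↔
      ∀ i j : Fin 2,
        A ⟨2 * i.1, by omega⟩ ⟨2 * j.1, by omega⟩ =
          sigmaW p k (A ⟨2 * i.1 + 1, by omega⟩ ⟨2 * j.1 + 1, by omega⟩) ∧
        A ⟨2 * i.1, by omega⟩ ⟨2 * j.1 + 1, by omega⟩ =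
          -(p : WittVector p k) *
            sigmaW p k (A ⟨2 * i.1 + 1, by omega⟩ ⟨2 * j.1, by omega⟩) ∧
        sigmaW p k (sigmaW p k (A ⟨2 * i.1 + 1, by omega⟩ ⟨2 * j.1 + 1, by omega⟩)) =
          A ⟨2 * i.1 + 1, by omega⟩ ⟨2 * j.1 + 1, by omega⟩ ∧
        sigmaW p k (sigmaW p k (A ⟨2 * i.1 + 1, by omega⟩ ⟨2 * j.1, by omega⟩)) =
          A ⟨2 * i.1 + 1, by omega⟩ ⟨2 * j.1, by omega⟩ := by
  have hp : (p : WittVector p k) ≠ 0 := WittVector.p_nonzero p k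
  constructor
  · intro h
    have h0 := h (eW p k 0)
    have h1 := h (eW p k 1)
    have h2 := h (eW p k 2)
    have h3 := h (eW p k 3)
    simp [funext_iff, Fin.forall_fin_succ, eW, Fmap, Matrix.mulVec, dotProduct,
      Fin.sum_univ_four] at h0 h2
    simp [funext_iff, Fin.forall_fin_succ, eW, Fmap, Matrix.mulVec, dotProduct,
      Fin.sum_univ_four, hp, h0, h2, mul_comm _ (p : WittVector p k)] at h1 h3
    simp [Fin.forall_fin_two]
    grind
  · intro h x
    simp [Fin.forall_fin_two] at h
    ext i : 1
    fin_cases i <;> simp [Fmap, Matrix.mulVec, dotProduct, Fin.sum_univ_four, h] <;> ring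

end
end

section
/- Let φ be a W-linear endomorphism of N with matrix A = (a_{ij}) commuting with F, and let b ∈ k. Then φ(M_b) ⊆ M_b if and only if (ρ(a₁₁) + ρ(a₁₃)·b)·b = ρ(a₃₁) + ρ(a₃₃)·b in k; equivalently, if and only if the k-linear map induced by φ on N/V(N) maps the line spanned by the class of e₁ + b̃e₃ into itself. -/
/-!
Common setup: `p` a prime, `k` an algebraically closed field of characteristic `p`,
`W = W(k)` the ring of `p`-typical Witt vectors, `σ` the Witt vector Frobenius,
`ρ : W → k` reduction (0-th coefficient), `N = W⁴` with the semilinear maps `F`, `V`,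
the Gram matrix `J'` of the alternating form, the Dieudonné submodules `M_b`, and the
coordinate map `q` for `N/V(N)`.
-/

noncomputable section

open WittVector Matrix

variable (p : ℕ) [Fact p.Prime] (k : Type) [Field k] [IsAlgClosed k] [CharP k p]

@[simp]
lemma redW_teichmuller (b : k) : redW p k (teichmuller p b) = b :=
  teichmuller_coeff_zero p b

lemma dvd_of_redW_eq_zero {x : WittVector p k} (hx : redW p k x = 0) :
    (p : WittVector p k) ∣ x :=
  Ideal.mem_span_singleton.1 ((mem_span_p_iff_coeff_zero_eq_zero x).2 hx)

lemma mem_Mmod_iff (b : k) (x : Fin 4 → WittVector p k) :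
    x ∈ Mmod p k b ↔ redW p k (x 2) = redW p k (x 0) * b := by
  constructor
  · intro hx
    induction hx using Submodule.span_induction with
    | mem x hx =>
      rcases hx with rfl | rfl | rfl | rfl | rfl <;> simp [eW]
    | zero => simp
    | add x y _ _ hx hy => simp [hx, hy, add_mul]
    | smul a x _ hx => simp [hx, mul_assoc]
  · intro hx
    obtain ⟨t, ht⟩ : (p : WittVector p k) ∣ x 2 - x 0 * teichmuller p b :=
      dvd_of_redW_eq_zero p k (by simp [hx])
    have hdecomp : x = x 0 • (eW p k 0 + teichmuller p b • eW p k 2) + x 1 • eW p k 1 +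
        x 3 • eW p k 3 + t • ((p : WittVector p k) • eW p k 2) := by
      funext i
      fin_cases i <;> simp [eW]
      linear_combination ht
    rw [hdecomp]
    have hmem : ∀ {y}, y ∈ ({(p : WittVector p k) • eW p k 0, (p : WittVector p k) • eW p k 2,
        eW p k 1, eW p k 3, eW p k 0 + teichmuller p b • eW p k 2} :
          Set (Fin 4 → WittVector p k)) → y ∈ Mmod p k b := fun hy => Submodule.subset_span hy
    refine add_mem (add_mem (add_mem ?_ ?_) ?_) ?_ <;>
      exact Submodule.smul_mem _ _ (hmem (by simp))

/-- Modulo `p`, an endomorphism commuting with `F` sends `e₂` and `e₄` into `V(N)`. -/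
lemma CommF.redW_eq_zero {A : Matrix (Fin 4) (Fin 4) (WittVector p k)} (hF : CommF p k A) :
    redW p k (A 0 1) = 0 ∧ redW p k (A 2 1) = 0 ∧
      redW p k (A 0 3) = 0 ∧ redW p k (A 2 3) = 0 := by
  have h (j i : Fin 4) := congrFun (hF (eW p k j)) i
  have h00 := h 0 0
  have h02 := h 0 2
  have h20 := h 2 0
  have h22 := h 2 2
  simp [Fmap, eW, Matrix.mulVec, dotProduct, Fin.sum_univ_four] at h00 h02 h20 h22
  simp [h00, h02, h20, h22]

/-- for `φ` commuting with `F`, `φ(M_b) ⊆ M_b` iff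
`(ρ(a₁₁) + ρ(a₁₃)·b)·b = ρ(a₃₁) + ρ(a₃₃)·b`, i.e. the induced map on `N/V(N)` preserves
the line spanned by the class of `e₁ + b̃ e₃`. -/
theorem mapsTo_Mb_iff
    (A : Matrix (Fin 4) (Fin 4) (WittVector p k)) (hF : CommF p k A) (b : k) :
    (∀ x ∈ Mmod p k b, A.mulVec x ∈ Mmod p k b) ↔
      (redW p k (A 0 0) + redW p k (A 0 2) * b) * b =
        redW p k (A 2 0) + redW p k (A 2 2) * b := by
  obtain ⟨h01, h21, h03, h23⟩ := hF.redW_eq_zero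
  have hrow (x : Fin 4 → WittVector p k) :
      redW p k (A.mulVec x 0) =
          redW p k (A 0 0) * redW p k (x 0) + redW p k (A 0 2) * redW p k (x 2) ∧
        redW p k (A.mulVec x 2) =
          redW p k (A 2 0) * redW p k (x 0) + redW p k (A 2 2) * redW p k (x 2) := by
    simp [Matrix.mulVec, dotProduct, Fin.sum_univ_four, h01, h21, h03, h23]
  simp only [mem_Mmod_iff, hrow]
  constructor
  · intro h
    simpa [eW] using (h (eW p k 0 + teichmuller p b • eW p k 2) (by simp [eW])).symm
  · intro h x hx
    rw [hx]
    linear_combination -redW p k (x 0) * h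

end
end

section
/- Let α, β ∈ 𝔽 be such that the polynomial X² − αX − β is irreducible over 𝔽, and let M = ((0,1),(β,α)) ∈ M₂(𝔽) be the matrix with first row (0,1) and second row (β,α). Then H = {T ∈ SL₂(𝔽) : T = t₁·I + t₂·M for some t₁, t₂ ∈ 𝔽} is a subgroup of SL₂(𝔽) of cardinality p² + 1, and its index in SL₂(𝔽) equals p⁴ − p². -/
open Matrix in
/-- The special linear group of degree `2` over a finite field with `q` elements has
`q (q² - 1)` elements. -/
theorem card_SL2_field (F : Type*) [Field F] [Fintype F] :
    Nat.card (SpecialLinearGroup (Fin 2) F) =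
      Fintype.card F * (Fintype.card F ^ 2 - 1) := by
  have hker : (SpecialLinearGroup.toGL : SpecialLinearGroup (Fin 2) F →* GL (Fin 2) F).range =
      (GeneralLinearGroup.det : GL (Fin 2) F →* Fˣ).ker := by
    apply SetLike.coe_injective
    rw [MonoidHom.coe_range, SpecialLinearGroup.range_toGL]
    rfl
  have hSL : Nat.card (SpecialLinearGroup (Fin 2) F) =
      Nat.card (GeneralLinearGroup.det : GL (Fin 2) F →* Fˣ).ker := by
    rw [← hker]
    exact Nat.card_congr
      (MonoidHom.ofInjective SpecialLinearGroup.toGL_injective).toEquiv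
  have hidx : (GeneralLinearGroup.det : GL (Fin 2) F →* Fˣ).ker.index = Fintype.card F - 1 := by
    rw [Subgroup.index_ker, MonoidHom.range_eq_top.mpr GeneralLinearGroup.det_surjective,
      Subgroup.card_top, Nat.card_units, Nat.card_eq_fintype_card]
  have hmul := (GeneralLinearGroup.det : GL (Fin 2) F →* Fˣ).ker.card_mul_index
  rw [hidx, ← hSL, card_GL_field, Fin.prod_univ_two] at hmul
  have hq : 1 < Fintype.card F := Fintype.one_lt_card
  refine Nat.eq_of_mul_eq_mul_right (Nat.sub_pos_of_lt hq) (hmul.trans ?_)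
  simp only [Fin.val_zero, Fin.val_one, pow_zero, pow_one]
  rw [show Fintype.card F ^ 2 - Fintype.card F = Fintype.card F * (Fintype.card F - 1) by
    rw [Nat.mul_sub, mul_one, sq]]
  ring

open Polynomial in
theorem quadratic_ne_zero_of_irreducible {F : Type*} [Field F] {α β : F}
    (hirr : Irreducible (X ^ 2 - C α * X - C β : F[X])) (s : F) :
    s ^ 2 - α * s - β ≠ 0 := by
  intro hs
  have hdeg : (X ^ 2 - C α * X - C β : F[X]).natDegree = 2 := by compute_degree!
  refine hirr.not_isRoot_of_natDegree_ne_one (by omega) (x := s) ?_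
  simpa [IsRoot] using hs

/-- The norm conic `a² + αab - βb² = 1` of a quadratic form without nontrivial zeros over a finite
field with `q` elements has `q + 1` points, one for each line through `(1, 0)`. -/
theorem card_norm_conic {F : Type*} [Field F] [Fintype F] {α β : F}
    (hroot : ∀ s : F, s ^ 2 - α * s - β ≠ 0) :
    Nat.card {x : F × F // x.1 ^ 2 + α * x.1 * x.2 - β * x.2 ^ 2 = 1} =
      Fintype.card F + 1 := by
  have hN (s : F) : s ^ 2 + α * s - β ≠ 0 := by
    simpa using hroot (-s)
  have hchar : (2 : F) = 0 → α ≠ 0 := by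
    rintro h2 rfl
    have : CharP F 2 := CharTwo.of_one_ne_zero_of_two_eq_zero one_ne_zero h2
    obtain ⟨r, hr⟩ := isSquare_of_charTwo' β
    exact hroot r (by rw [hr]; ring)
  let t (s : F) : F := -(2 * s + α) / (s ^ 2 + α * s - β)
  have ht (s : F) : t s * (s ^ 2 + α * s - β) = -(2 * s + α) := div_mul_cancel₀ _ (hN s)
  let f : Option F → {x : F × F // x.1 ^ 2 + α * x.1 * x.2 - β * x.2 ^ 2 = 1}
    | none => ⟨(-1, 0), by ring⟩
    | some s => ⟨(1 + s * t s, t s), by linear_combination t s * ht s⟩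
  have hnone (s : F) : f (some s) ≠ f none := by
    intro h
    have h1 : 1 + s * t s = -1 := congrArg (fun x => x.1.1) h
    have h2 : t s = 0 := congrArg (fun x => x.1.2) h
    have hs := ht s
    rw [h2] at h1 hs
    have h20 : (2 : F) = 0 := by linear_combination h1
    exact hchar h20 (by linear_combination hs - s * h20)
  have hinj : Function.Injective f := by
    rintro (_ | s) (_ | r) h
    · rfl
    · exact absurd h.symm (hnone r)
    · exact absurd h (hnone s)
    · have h1 : 1 + s * t s = 1 + r * t r := congrArg (fun x => x.1.1) h
      have h2 : t s = t r := congrArg (fun x => x.1.2) h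
      have h3 : (s - r) * t r = 0 := by linear_combination h1 - s * h2
      rcases mul_eq_zero.mp h3 with h4 | h4
      · rw [sub_eq_zero.mp h4]
      · have hs := ht s
        have hr := ht r
        rw [h2, h4] at hs
        rw [h4] at hr
        have h5 : (2 : F) * (s - r) = 0 := by linear_combination hs - hr
        rcases mul_eq_zero.mp h5 with h6 | h6
        · exact absurd (by linear_combination hs - s * h6) (hchar h6)
        · rw [sub_eq_zero.mp h6]
  have hsurj : Function.Surjective f := by
    rintro ⟨⟨a, b⟩, hab⟩
    have hab' : a ^ 2 + α * a * b - β * b ^ 2 = 1 := hab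
    by_cases hb : b = 0
    · subst hb
      by_cases ha : a = -1
      · exact ⟨none, Subtype.ext (Prod.ext ha.symm rfl)⟩
      · have ha1 : a = 1 := by
          refine sub_eq_zero.mp ((mul_eq_zero.mp (?_ : (a + 1) * (a - 1) = 0)).resolve_left ?_)
          · linear_combination hab'
          · exact fun h => ha (eq_neg_of_add_eq_zero_left h)
        have h2 : (2 : F) ≠ 0 := fun h => ha (by linear_combination ha1 + h)
        have ht0 : t (-α / 2) = 0 := by
          simp only [t]
          rw [mul_div_cancel₀ _ h2]
          simp
        exact ⟨some (-α / 2), Subtype.ext (Prod.ext (by simp [f, ht0, ha1]) ht0)⟩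
    · have htb : t ((a - 1) / b) = b := by
        refine mul_right_cancel₀ (hN ((a - 1) / b)) ((ht _).trans ?_)
        field_simp
        linear_combination -hab'
      refine ⟨some ((a - 1) / b), Subtype.ext (Prod.ext ?_ htb)⟩
      simp only [f, htb]
      field_simp
      ring
  rw [← Nat.card_congr (Equiv.ofBijective f ⟨hinj, hsurj⟩), Nat.card_eq_fintype_card,
    Fintype.card_option]

theorem det_smul_one_add_smul_companion {R : Type*} [CommRing R] (α β a b : R) :
    (a • (1 : Matrix (Fin 2) (Fin 2) R) + b • !![0, 1; β, α]).det =
      a ^ 2 + α * a * b - β * b ^ 2 := by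
  simp [Matrix.det_fin_two]
  ring

/-- The matrices of determinant `1` in the subalgebra spanned by `1` and the companion
matrix of `X² - αX - β`. -/
def companionTorus {R : Type*} [CommRing R] (α β : R) :
    Subgroup (Matrix.SpecialLinearGroup (Fin 2) R) where
  carrier := {T | ∃ t₁ t₂ : R, (T : Matrix (Fin 2) (Fin 2) R) =
    t₁ • (1 : Matrix (Fin 2) (Fin 2) R) + t₂ • !![0, 1; β, α]}
  one_mem' := ⟨1, 0, by simp⟩
  mul_mem' := by
    rintro S T ⟨a, b, hS⟩ ⟨c, d, hT⟩
    refine ⟨a * c + β * b * d, a * d + b * c + α * b * d, ?_⟩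
    rw [Matrix.SpecialLinearGroup.coe_mul, hS, hT]
    ext i j
    fin_cases i <;> fin_cases j <;> simp [Matrix.mul_apply, Fin.sum_univ_two] <;> ring
  inv_mem' := by
    rintro T ⟨a, b, hT⟩
    refine ⟨a + α * b, -b, ?_⟩
    rw [Matrix.SpecialLinearGroup.coe_inv, hT, Matrix.adjugate_fin_two]
    ext i j
    fin_cases i <;> fin_cases j <;> simp <;> ring

theorem card_companionTorus {R : Type*} [CommRing R] (α β : R) :
    Nat.card (companionTorus α β) =
      Nat.card {x : R × R // x.1 ^ 2 + α * x.1 * x.2 - β * x.2 ^ 2 = 1} := by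
  let f (x : {x : R × R // x.1 ^ 2 + α * x.1 * x.2 - β * x.2 ^ 2 = 1}) : companionTorus α β :=
    ⟨⟨x.1.1 • 1 + x.1.2 • !![0, 1; β, α],
      (det_smul_one_add_smul_companion α β x.1.1 x.1.2).trans x.2⟩, x.1.1, x.1.2, rfl⟩
  refine (Nat.card_congr (Equiv.ofBijective f ⟨fun x y h => ?_, ?_⟩)).symm
  · have hM : x.1.1 • (1 : Matrix (Fin 2) (Fin 2) R) + x.1.2 • !![0, 1; β, α] =
        y.1.1 • 1 + y.1.2 • !![0, 1; β, α] := congrArg (fun T => T.1.1) h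
    refine Subtype.ext (Prod.ext ?_ ?_)
    · simpa using congrFun₂ hM 0 0
    · simpa using congrFun₂ hM 0 1
  · rintro ⟨T, a, b, hT⟩
    refine ⟨⟨(a, b), ?_⟩, Subtype.ext (Subtype.ext hT.symm)⟩
    rw [← det_smul_one_add_smul_companion, ← hT, T.det_coe]


/-- for `𝔽` a finite field with `p²` elements and `X² - αX - β` irreducible
over `𝔽`, the set `{T ∈ SL₂(𝔽) : T = t₁·I + t₂·((0,1),(β,α))}` is a subgroup of `SL₂(𝔽)`
of cardinality `p² + 1` and of index `p⁴ - p²`. -/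
theorem subgroup_of_SL2_from_irreducible_quadratic
    (p : ℕ) [Fact p.Prime] (𝔽 : Type) [Field 𝔽] [Fintype 𝔽]
    (hcard : Fintype.card 𝔽 = p ^ 2)
    (α β : 𝔽)
    (hirr : Irreducible (Polynomial.X ^ 2 - Polynomial.C α * Polynomial.X -
      Polynomial.C β : Polynomial 𝔽)) :
    ∃ H : Subgroup (Matrix.SpecialLinearGroup (Fin 2) 𝔽),
      (H : Set (Matrix.SpecialLinearGroup (Fin 2) 𝔽)) =
        {T : Matrix.SpecialLinearGroup (Fin 2) 𝔽 | ∃ t₁ t₂ : 𝔽,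
          (T : Matrix (Fin 2) (Fin 2) 𝔽) =
            t₁ • (1 : Matrix (Fin 2) (Fin 2) 𝔽) + t₂ • !![0, 1; β, α]} ∧
      Nat.card H = p ^ 2 + 1 ∧
      H.index = p ^ 4 - p ^ 2 := by
  have hH : Nat.card (companionTorus α β) = p ^ 2 + 1 := by
    rw [card_companionTorus, card_norm_conic (quadratic_ne_zero_of_irreducible hirr), hcard]
  refine ⟨companionTorus α β, rfl, hH, ?_⟩
  have hmul := (companionTorus α β).card_mul_index
  rw [hH, card_SL2_field, hcard] at hmul
  refine Nat.eq_of_mul_eq_mul_left (Nat.succ_pos (p ^ 2)) (hmul.trans ?_)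
  have h4 : p ^ 4 - p ^ 2 = p ^ 2 * (p ^ 2 - 1) := by
    rw [Nat.mul_sub, mul_one, ← pow_add]
  have h5 : (p ^ 2) ^ 2 - 1 = (p ^ 2 + 1) * (p ^ 2 - 1) := by
    simpa using Nat.sq_sub_sq (p ^ 2) 1
  rw [h4, h5, Nat.mul_left_comm]
end
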